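/- For k in the last column interval C_{⌈l/2⌉} with l odd (so the bottom block of the AIR matrix is the fat block I_{β_l λ_l × λ_l}), the down-distance satisfies d_down(k) = K − D − 1. -/

import Mathlib

/-- Euclidean chain: `lam K D 0 = λ_{-1} = D+1`, `lam K D 1 = λ_0 = K-D-1`, and
`lam K D (i+1) = λ_i` is the remainder of `λ_{i-2}` divided by `λ_{i-1}`
(with the convention that once a term is `0`, all later terms are `0`). -/
def lam (K D : ℕ) : ℕ → ℕ
  | 0 => D + 1
  | 1 => K - D - 1
  | (n + 2) => if lam K D (n + 1) = 0 then 0 else lam K D n % lam K D (n + 1)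

/-- The AIR (Adjacent-Row-Independent) matrix construction: `airFill m n j k = true`
iff the `(j,k)` entry of the `m × n` AIR matrix is `1`.  The first `m - m % n` rows
are stacked `n × n` identities; the remaining `(m % n) × n` part is the transpose of
the `n × (m % n)` AIR matrix. -/
def airFill : ℕ → ℕ → ℕ → ℕ → Bool
  | m, n, j, k =>
    if h : n = 0 then false
    else if j < m - m % n then decide (j % n = k)
    else airFill n (m % n) k (j - (m - m % n))
  termination_by m n _ _ => n
  decreasing_by exact Nat.mod_lt _ (Nat.pos_of_ne_zero h)

/-- Down-distance: distance from the diagonal `1` at `(k,k)` to the lowest `1`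
in column `k` of the `K × (D+1)` AIR matrix. -/
def ddown (K D k : ℕ) : ℕ :=
  (((Finset.range K).filter (fun j => airFill K (D+1) j k = true)).sup id) - k

/-- Up-distance: distance from the `1` at `(j,k)` to the nearest `1` above it in column `k`. -/
def dup (K D j k : ℕ) : ℕ :=
  j - (((Finset.range j).filter (fun j' => airFill K (D+1) j' k = true)).sup id)

/-- Right-distance: distance from the `1` at `(j,k)` to the nearest `1` to its right in row `j`. -/
noncomputable def dright (K D j k : ℕ) : ℕ :=
  sInf {k' : ℕ | k < k' ∧ airFill K (D+1) j k' = true} - k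

theorem lam_ne_zero_of_succ (K D n : ℕ) (h : lam K D (n + 1) ≠ 0) : lam K D n ≠ 0 := by
  cases n with
  | zero => simp [lam]
  | succ n =>
    intro h0
    exact h (by rw [lam, if_pos h0])

/-- Consecutive nonzero terms of the Euclidean chain keep the same greatest common divisor. -/
theorem gcd_lam_lam_succ (K D n : ℕ) (h : lam K D n ≠ 0) :
    Nat.gcd (lam K D n) (lam K D (n + 1)) = Nat.gcd (D + 1) (K - D - 1) := by
  induction n with
  | zero => simp [lam]
  | succ n ih =>
    rw [← ih (lam_ne_zero_of_succ K D n h), lam, if_neg h, Nat.gcd_comm, ← Nat.gcd_rec,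
      Nat.gcd_comm]

/-- The bottom-right square block of size `gcd m n` of the `m × n` AIR matrix is the identity. -/
theorem airFill_bottom_right (m n : ℕ) (hm : 0 < m) (hn : 0 < n) (i i' : ℕ)
    (hi : i < Nat.gcd m n) (hi' : i' < Nat.gcd m n) :
    airFill m n (m - Nat.gcd m n + i) (n - Nat.gcd m n + i') = decide (i = i') := by
  induction n using Nat.strong_induction_on generalizing m i i' with
  | _ n ih =>
    rw [airFill, dif_neg hn.ne']
    have hgm : Nat.gcd m n ≤ m := Nat.gcd_le_left _ hm
    rcases Nat.eq_zero_or_pos (m % n) with hr | hr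
    · have hdvd := Nat.dvd_of_mod_eq_zero hr
      rw [Nat.gcd_eq_right hdvd] at hi hi' hgm ⊢
      have hmod : (m - n + i) % n = i := by
        obtain ⟨c, hc⟩ := Nat.dvd_sub hdvd dvd_rfl
        rw [hc, Nat.mul_add_mod, Nat.mod_eq_of_lt hi]
      rw [if_pos (by omega), hmod, Nat.sub_self, Nat.zero_add]
    · have hg : Nat.gcd n (m % n) = Nat.gcd m n := by
        rw [Nat.gcd_comm, ← Nat.gcd_rec, Nat.gcd_comm]
      have hgr : Nat.gcd m n ≤ m % n := hg ▸ Nat.gcd_le_right _ hr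
      have hrm : m % n ≤ m := Nat.mod_le m n
      have h := ih (m % n) (Nat.mod_lt _ hn) n hn hr i' i (by rwa [hg]) (by rwa [hg])
      rw [hg] at h
      rw [if_neg (by omega),
        show m - Nat.gcd m n + i - (m - m % n) = m % n - Nat.gcd m n + i by omega, h]
      exact decide_eq_decide.2 eq_comm

/-- For `k` in the last column interval `C_{⌈l/2⌉} = [D + 1 - λ_l, D]` with `l` odd
(so the bottom block of the AIR matrix is the fat block `I_{β_lλ_l × λ_l}`),
the down-distance satisfies `d_down(k) = K - D - 1`. -/
theorem stmt11 (K D l k : ℕ) (hDK : D + 1 < K)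
    (hl : lam K D (l + 1) ≠ 0) (hl' : lam K D (l + 2) = 0)
    (hlodd : Odd l)
    (hk1 : D + 1 - lam K D (l+1) ≤ k) (hk2 : k ≤ D) :
    ddown K D k = K - D - 1 := by
  have hg : lam K D (l + 1) = Nat.gcd K (D + 1) := by
    have h := gcd_lam_lam_succ K D (l + 1) hl
    rw [hl', Nat.gcd_zero_right] at h
    rw [h, Nat.sub_sub, Nat.gcd_comm, Nat.gcd_sub_self_left hDK.le]
  have hgK : Nat.gcd K (D + 1) ≤ K := Nat.gcd_le_left _ (by omega)
  have hgD : Nat.gcd K (D + 1) ≤ D + 1 := Nat.gcd_le_right _ (by omega)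
  rw [hg] at hk1
  have key := airFill_bottom_right K (D + 1) (by omega) (by omega)
  generalize Nat.gcd K (D + 1) = g at *
  have hcol : D + 1 - g + (k - (D + 1 - g)) = k := by omega
  have hsup : ((Finset.range K).filter (fun j => airFill K (D + 1) j k = true)).sup id
      = k + (K - D - 1) := by
    apply le_antisymm
    · refine Finset.sup_le fun j hj => ?_
      obtain ⟨hjK, hj⟩ := Finset.mem_filter.1 hj
      rw [Finset.mem_range] at hjK
      by_contra! hlt
      simp only [id] at hlt
      have h := key (j - (K - g)) (k - (D + 1 - g)) (by omega) (by omega)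
      rw [hcol, show K - g + (j - (K - g)) = j by omega, hj, eq_comm, decide_eq_true_iff] at h
      omega
    · refine Finset.le_sup (f := id) (Finset.mem_filter.2 ⟨Finset.mem_range.2 (by omega), ?_⟩)
      have h := key (k - (D + 1 - g)) (k - (D + 1 - g)) (by omega) (by omega)
      rw [hcol, show K - g + (k - (D + 1 - g)) = k + (K - D - 1) by omega] at h
      simpa using h
  rw [ddown, hsup, Nat.add_sub_cancel_left]
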